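/- Splitting lemma for covering families: given a set U of cardinality n and integers 0 ≤ a, b ≤ n, there exists a family F of at most 2^{O(min(a,b)·log(a+b))}·log n subsets of U such that for any disjoint sets A, B ⊆ U with |A| ≤ a and |B| ≤ b, there is S ∈ F with A ⊆ S and B ∩ S = ∅. -/

import Mathlib

open Finset

/-- Greedy covering. -/
lemma greedy_cover {Ω P : Type*} [Fintype Ω] [DecidableEq Ω] (R : P → Ω → Prop)
    (X : Finset P) (p : ℝ) (hp1 : p ≤ 1) (hΩ : 0 < Fintype.card Ω)
    (h : ∀ x ∈ X, ∃ G : Finset Ω, (∀ w ∈ G, R x w) ∧ p * Fintype.card Ω ≤ G.card) (m : ℕ) :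
    ∃ T : Finset Ω, T.card ≤ m ∧ ∃ Y ⊆ X, (∀ x ∈ X, x ∉ Y → ∃ w ∈ T, R x w) ∧
      (Y.card : ℝ) ≤ X.card * (1 - p) ^ m := by
  classical
  induction m with
  | zero => exact ⟨∅, by simp, X, subset_rfl, fun x hx hx' => absurd hx hx', by simp⟩
  | succ m ih =>
    obtain ⟨T, hT, Y, hYX, hcov, hY⟩ := ih
    have key : ∃ w : Ω, p * Y.card ≤ ((Y.filter (fun x => R x w)).card : ℝ) := by
      by_contra! hcon
      have h1 : ∑ w : Ω, ((Y.filter (fun x => R x w)).card : ℝ) < ∑ w : Ω, p * Y.card :=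
        Finset.sum_lt_sum_of_nonempty
          (by rw [← Finset.card_pos]; simpa using hΩ) (fun w _ => hcon w)
      have h2 : ∑ w : Ω, (Y.filter (fun x => R x w)).card
          = ∑ x ∈ Y, ((univ : Finset Ω).filter (fun w => R x w)).card := by
        simp only [Finset.card_filter]
        exact Finset.sum_comm
      have h3 : ∑ x ∈ Y, p * Fintype.card Ω
          ≤ ∑ x ∈ Y, (((univ : Finset Ω).filter (fun w => R x w)).card : ℝ) := by
        refine Finset.sum_le_sum fun x hx => ?_
        obtain ⟨G, hG, hGc⟩ := h x (hYX hx)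
        refine hGc.trans ?_
        exact_mod_cast Finset.card_le_card (fun w hw => by simpa using hG w hw)
      have h2' : ∑ w : Ω, ((Y.filter (fun x => R x w)).card : ℝ)
          = ∑ x ∈ Y, (((univ : Finset Ω).filter (fun w => R x w)).card : ℝ) := by
        exact_mod_cast h2
      rw [h2'] at h1
      simp only [Finset.sum_const, nsmul_eq_mul, Finset.card_univ] at h1 h3
      nlinarith
    obtain ⟨w, hw⟩ := key
    refine ⟨insert w T, (Finset.card_insert_le _ _).trans (by omega),
      Y.filter (fun x => ¬ R x w), (Finset.filter_subset _ _).trans hYX, ?_, ?_⟩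
    · intro x hx hxY
      by_cases hxw : R x w
      · exact ⟨w, by simp, hxw⟩
      · obtain ⟨v, hv, hvR⟩ := hcov x hx (fun hxy => hxY (by simp [hxy, hxw]))
        exact ⟨v, by simp [hv], hvR⟩
    · have hsum := Finset.card_filter_add_card_filter_not (s := Y) (fun x => R x w)
      have hsum' : ((Y.filter (fun x => R x w)).card : ℝ)
          + ((Y.filter (fun x => ¬ R x w)).card : ℝ) = Y.card := by exact_mod_cast hsum
      have : ((Y.filter (fun x => ¬ R x w)).card : ℝ) ≤ (1 - p) * Y.card := by linarith
      refine this.trans ?_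
      rw [pow_succ]
      have := mul_le_mul_of_nonneg_left hY (sub_nonneg.2 hp1)
      linarith

lemma card_small_subsets {α : Type*} (U : Finset α) (a : ℕ) :
    (U.powerset.filter (fun A => A.card ≤ a)).card ≤ (U.card + 1) ^ a := by
  classical
  have h1 : U.powerset.filter (fun A => A.card ≤ a) ⊆
      (range (a + 1)).biUnion (fun i => U.powersetCard i) := by
    intro A hA
    simp only [mem_filter, mem_powerset] at hA
    simp only [mem_biUnion, mem_range, mem_powersetCard]
    exact ⟨A.card, by omega, hA.1, rfl⟩
  refine (Finset.card_le_card h1).trans (Finset.card_biUnion_le.trans ?_)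
  rw [add_pow]
  refine Finset.sum_le_sum fun i hi => ?_
  rw [Finset.card_powersetCard, one_pow, mul_one]
  have h2 : 0 < a.choose i := Nat.choose_pos (by simp at hi; omega)
  exact (Nat.choose_le_pow _ _).trans (Nat.le_mul_of_pos_right _ h2)

lemma good_functions {α : Type*} [DecidableEq α] (U A B : Finset α) (a b : ℕ)
    (hA : A ⊆ U) (hB : B ⊆ U) (hAB : Disjoint A B) (ha : A.card ≤ a) (hb : B.card ≤ b) :
    ∃ G : Finset (U → Fin (a + b + 2)),
      (∀ w ∈ G, (∀ x : U, x.1 ∈ A → w x = 0) ∧ (∀ x : U, x.1 ∈ B → w x ≠ 0)) ∧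
      (((a : ℝ) + b + 2) ^ (a + 1))⁻¹ * Fintype.card (U → Fin (a + b + 2)) ≤ G.card := by
  classical
  set q : ℝ := (a : ℝ) + b + 2 with hq
  have hq2 : 2 ≤ q := by rw [hq]; have : (0:ℝ) ≤ a := by positivity
                         have : (0:ℝ) ≤ b := by positivity
                         linarith
  have hq0 : 0 < q := by linarith
  let t : U → Finset (Fin (a + b + 2)) := fun x =>
    if x.1 ∈ A then {0} else if x.1 ∈ B then univ.erase 0 else univ
  refine ⟨Fintype.piFinset t, ?_, ?_⟩
  · intro w hw
    rw [Fintype.mem_piFinset] at hw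
    refine ⟨fun x hx => ?_, fun x hx => ?_⟩
    · have := hw x
      simpa [t, hx] using this
    · have hxA : x.1 ∉ A := fun h => (Finset.disjoint_left.1 hAB) h hx
      have := hw x
      simpa [t, hx, hxA] using this
  · have ht : ∀ x : U, ((t x).card : ℝ) =
        q * ((if x.1 ∈ A then q⁻¹ else 1) * (if x.1 ∈ B then (1 - q⁻¹) else 1)) := by
      intro x
      by_cases hxA : x.1 ∈ A
      · have hxB : x.1 ∉ B := Finset.disjoint_left.1 hAB hxA
        simp [t, hxA, hxB, hq0.ne']
      · by_cases hxB : x.1 ∈ B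
        · simp only [t, hxA, hxB, if_true, if_false, one_mul]
          rw [Finset.card_erase_of_mem (mem_univ _), Finset.card_univ, Fintype.card_fin,
            mul_sub, mul_inv_cancel₀ hq0.ne', hq]
          push_cast [Nat.add_sub_cancel]
          ring
        · simp [t, hxA, hxB, hq]
    rw [Fintype.card_piFinset]
    push_cast
    rw [Finset.prod_congr rfl (fun x _ => ht x), Finset.prod_mul_distrib,
      Finset.prod_mul_distrib]
    have e1 : ∏ x : U, (if x.1 ∈ A then q⁻¹ else 1) = q⁻¹ ^ A.card := by
      rw [Finset.prod_coe_sort U (fun x => if x ∈ A then q⁻¹ else 1), Finset.prod_ite_mem,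
        Finset.inter_eq_right.2 hA, Finset.prod_const]
    have e2 : ∏ x : U, (if x.1 ∈ B then (1 - q⁻¹) else 1) = (1 - q⁻¹) ^ B.card := by
      rw [Finset.prod_coe_sort U (fun x => if x ∈ B then (1 - q⁻¹) else 1), Finset.prod_ite_mem,
        Finset.inter_eq_right.2 hB, Finset.prod_const]
    rw [e1, e2]
    have e3 : (Fintype.card (U → Fin (a + b + 2)) : ℝ) = ∏ x : U, q := by
      simp [hq]
    rw [e3, mul_comm]
    have hqi0 : 0 < q⁻¹ := inv_pos.2 hq0
    have hqi1 : q⁻¹ ≤ 1 := inv_le_one_of_one_le₀ (by linarith)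
    refine mul_le_mul_of_nonneg_left ?_ (by positivity)
    rw [← inv_pow, pow_succ]
    have f1 : q⁻¹ ^ a ≤ q⁻¹ ^ A.card := pow_le_pow_of_le_one hqi0.le hqi1 ha
    have f2 : q⁻¹ ≤ (1 - q⁻¹) ^ B.card := by
      have h1 : (1 - q⁻¹) ^ b ≤ (1 - q⁻¹) ^ B.card :=
        pow_le_pow_of_le_one (by linarith) (by linarith) hb
      have h2 := one_add_mul_le_pow (a := -q⁻¹) (by linarith) b
      have h3 : q⁻¹ ≤ 1 + (b : ℝ) * -q⁻¹ := by
        have : q⁻¹ * q = 1 := inv_mul_cancel₀ hq0.ne'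
        have h4 : (0:ℝ) ≤ a := by positivity
        rw [hq] at this
        nlinarith [mul_nonneg hqi0.le h4]
      rw [← sub_eq_add_neg] at h2
      linarith
    exact mul_le_mul f1 f2 hqi0.le (by positivity)

lemma splitting_asymm {α : Type*} (U : Finset α) (a b : ℕ) :
    ∃ F : Finset (Finset α), (∀ S ∈ F, S ⊆ U) ∧
      (F.card : ℝ) ≤ ((a : ℝ) + b + 2) ^ (a + 2) * (Real.log ((U.card : ℝ) + 1) + 1) ∧
      ∀ A B : Finset α, A ⊆ U → B ⊆ U → Disjoint A B → A.card ≤ a → B.card ≤ b →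
        ∃ S ∈ F, A ⊆ S ∧ Disjoint B S := by
  classical
  set q : ℝ := (a : ℝ) + b + 2 with hq
  have ha0 : (0:ℝ) ≤ a := by positivity
  have hb0 : (0:ℝ) ≤ b := by positivity
  have hq2 : 2 ≤ q := by linarith
  have hq0 : 0 < q := by linarith
  set L : ℝ := Real.log ((U.card : ℝ) + 1) with hL
  have hn0 : (0:ℝ) < (U.card : ℝ) + 1 := by positivity
  have hL0 : 0 ≤ L := Real.log_nonneg (by simp)
  have hQ1 : 1 ≤ q ^ (a + 1) := one_le_pow₀ (by linarith)
  set Q : ℝ := q ^ (a + 1) with hQ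
  have hQ0 : 0 < Q := by linarith
  let R : Finset α × Finset α → (U → Fin (a + b + 2)) → Prop := fun P w =>
    (∀ x : U, x.1 ∈ P.1 → w x = 0) ∧ (∀ x : U, x.1 ∈ P.2 → w x ≠ 0)
  let X := ((U.powerset.filter (fun A => A.card ≤ a)) ×ˢ
    (U.powerset.filter (fun A => A.card ≤ b))).filter (fun P => Disjoint P.1 P.2)
  have hX : (X.card : ℝ) ≤ Real.exp (((a : ℝ) + b) * L) := by
    have h1 : X.card ≤ (U.card + 1) ^ a * (U.card + 1) ^ b := by
      refine (Finset.card_filter_le _ _).trans ?_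
      rw [Finset.card_product]
      exact Nat.mul_le_mul (card_small_subsets U a) (card_small_subsets U b)
    have h2 : Real.exp (((a : ℝ) + b) * L) = ((U.card : ℝ) + 1) ^ (a + b) := by
      rw [hL, ← Nat.cast_add, Real.exp_nat_mul, Real.exp_log hn0]
    rw [h2, pow_add]
    exact_mod_cast h1
  set m := ⌊((a : ℝ) + b) * L * Q⌋₊ + 1 with hm
  have hm1 : ((a : ℝ) + b) * L * Q < m := by
    rw [hm]; push_cast; exact Nat.lt_floor_add_one _
  have hm2 : (m : ℝ) ≤ ((a : ℝ) + b) * L * Q + 1 := by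
    rw [hm]; push_cast
    have := Nat.floor_le (a := ((a : ℝ) + b) * L * Q) (by positivity)
    linarith
  have hp1 : Q⁻¹ ≤ 1 := inv_le_one_of_one_le₀ hQ1
  obtain ⟨T, hT, Y, hYX, hcov, hY⟩ := greedy_cover R X Q⁻¹ hp1
    (by rw [Fintype.card_pos_iff]; infer_instance)
    (by
      rintro ⟨A, B⟩ hP
      simp only [X, mem_filter, mem_product, mem_powerset] at hP
      exact good_functions U A B a b hP.1.1.1 hP.1.2.1 hP.2 hP.1.1.2 hP.1.2.2) m
  have hYlt : (Y.card : ℝ) < 1 := by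
    have h1 : (1 - Q⁻¹) ^ m ≤ Real.exp (-(m * Q⁻¹)) := by
      rw [← mul_neg, Real.exp_nat_mul]
      refine pow_le_pow_left₀ (by linarith) ?_ m
      have := Real.add_one_le_exp (-Q⁻¹)
      linarith
    calc (Y.card : ℝ) ≤ X.card * (1 - Q⁻¹) ^ m := hY
      _ ≤ Real.exp (((a : ℝ) + b) * L) * Real.exp (-(m * Q⁻¹)) :=
        mul_le_mul hX h1 (pow_nonneg (by linarith) _) (Real.exp_pos _).le
      _ = Real.exp (((a : ℝ) + b) * L - m * Q⁻¹) := by rw [← Real.exp_add, sub_eq_add_neg]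
      _ < 1 := by
        rw [Real.exp_lt_one_iff, sub_neg, ← div_eq_mul_inv, lt_div_iff₀ hQ0]
        exact hm1
  have hY0 : Y = ∅ := by
    rw [← Finset.card_eq_zero]
    have : Y.card < 1 := by exact_mod_cast hYlt
    omega
  refine ⟨T.image (fun w => (univ.filter (fun x : U => w x = 0)).map
    (Function.Embedding.subtype _)), ?_, ?_, ?_⟩
  · intro S hS
    simp only [mem_image] at hS
    obtain ⟨w, -, rfl⟩ := hS
    intro x hx
    simp only [mem_map] at hx
    obtain ⟨y, -, rfl⟩ := hx
    exact y.2
  · have h1 : ((T.image (fun w => (univ.filter (fun x : U => w x = 0)).map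
        (Function.Embedding.subtype _))).card : ℝ) ≤ m := by
      exact_mod_cast Finset.card_image_le.trans hT
    refine h1.trans (hm2.trans ?_)
    rw [pow_succ, ← hQ]
    have h3 : ((a : ℝ) + b) * (L * Q) ≤ q * (L * Q) :=
      mul_le_mul_of_nonneg_right (by linarith) (by positivity)
    nlinarith
  · intro A B hA hB hAB ha hb
    obtain ⟨w, hw, hR1, hR2⟩ := hcov (A, B) (by
      simp only [X, mem_filter, mem_product, mem_powerset]
      exact ⟨⟨⟨hA, ha⟩, hB, hb⟩, hAB⟩) (by simp [hY0])
    refine ⟨_, mem_image_of_mem _ hw, ?_, ?_⟩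
    · intro x hx
      simp only [mem_map, mem_filter, mem_univ, true_and]
      exact ⟨⟨x, hA hx⟩, hR1 ⟨x, hA hx⟩ hx, rfl⟩
    · rw [Finset.disjoint_left]
      intro x hx hx'
      simp only [mem_map, mem_filter, mem_univ, true_and] at hx'
      obtain ⟨y, hy, rfl⟩ := hx'
      exact hR2 y hx hy

lemma pow_bound (q : ℝ) (hq : 2 ≤ q) (k : ℕ) :
    q ^ (k + 2) ≤ (2 : ℝ) ^ (4 * ((k : ℝ) + 1) * Real.log q) := by
  have hq0 : 0 < q := by linarith
  rw [← Real.rpow_natCast, Real.rpow_def_of_pos hq0, Real.rpow_def_of_pos (by norm_num : (0:ℝ) < 2)]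
  apply Real.exp_le_exp.2
  have h1 : (0:ℝ) ≤ Real.log q := Real.log_nonneg (by linarith)
  have h2 : (0.5 : ℝ) < Real.log 2 := by have := Real.log_two_gt_d9; linarith
  have hk : (0:ℝ) ≤ k := by positivity
  push_cast
  have h3 : (k : ℝ) + 2 ≤ Real.log 2 * (4 * ((k : ℝ) + 1)) := by nlinarith
  nlinarith [mul_le_mul_of_nonneg_left h3 h1]

/-- Lemma 1.1 of Chitnis et al.. There is an absolute constant `C > 0`
such that for every finite set `U` of cardinality `n` and integers `0 ≤ a, b ≤ n` there is
a family `F` of at most `2^{C·min(a,b)·log(a+b)}·log n` subsets of `U` such that for all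
disjoint `A, B ⊆ U` with `|A| ≤ a` and `|B| ≤ b` there is `S ∈ F` with `A ⊆ S` and
`B ∩ S = ∅`. (The `+1`/`+2` offsets only absorb degenerate logarithms, as the `O(·)`
notation allows.) -/
theorem exists_splitting_family :
    ∃ C : ℝ, 0 < C ∧
      ∀ (α : Type) (U : Finset α) (a b : ℕ), a ≤ U.card → b ≤ U.card →
        ∃ F : Finset (Finset α),
          (∀ S ∈ F, S ⊆ U) ∧
          (F.card : ℝ) ≤
            (2 : ℝ) ^ (C * ((min a b : ℝ) + 1) * Real.log ((a : ℝ) + (b : ℝ) + 2)) *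
              (Real.log ((U.card : ℝ) + 1) + 1) ∧
          ∀ A B : Finset α, A ⊆ U → B ⊆ U → Disjoint A B →
            A.card ≤ a → B.card ≤ b →
            ∃ S ∈ F, A ⊆ S ∧ Disjoint B S := by
  classical
  refine ⟨4, by norm_num, fun α U a b _ _ => ?_⟩
  have ha0 : (0:ℝ) ≤ a := by positivity
  have hb0 : (0:ℝ) ≤ b := by positivity
  have hL0 : 0 ≤ Real.log ((U.card : ℝ) + 1) := Real.log_nonneg (by simp)
  rcases le_total a b with hab | hab
  · obtain ⟨F, hF, hc, hs⟩ := splitting_asymm U a b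
    refine ⟨F, hF, hc.trans ?_, hs⟩
    rw [min_eq_left (by exact_mod_cast hab : (a:ℝ) ≤ b)]
    exact mul_le_mul_of_nonneg_right (pow_bound _ (by linarith) a) (by linarith)
  · obtain ⟨F, hF, hc, hs⟩ := splitting_asymm U b a
    refine ⟨F.image (fun S => U \ S), ?_, ?_, ?_⟩
    · intro S hS
      obtain ⟨S', -, rfl⟩ := mem_image.1 hS
      exact sdiff_subset
    · have h1 : ((F.image (fun S => U \ S)).card : ℝ) ≤ F.card := by
        exact_mod_cast Finset.card_image_le
      refine h1.trans (hc.trans ?_)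
      rw [min_eq_right (by exact_mod_cast hab : (b:ℝ) ≤ a), add_comm (b:ℝ) a]
      exact mul_le_mul_of_nonneg_right (pow_bound _ (by linarith) b) (by linarith)
    · intro A B hA hB hAB ha hb
      obtain ⟨S, hS, hBS, hAS⟩ := hs B A hB hA hAB.symm hb ha
      refine ⟨U \ S, mem_image_of_mem _ hS, ?_, ?_⟩
      · exact Finset.subset_sdiff.2 ⟨hA, hAS⟩
      · exact Finset.disjoint_sdiff.mono_left hBS
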